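/- arXiv:math/0612177 — 4 statements merged into one kernel-verified Lean document; each statement's English description precedes it below -/
import Mathlib

section
/- Let (Ω,F,P) be a probability space and for each n,k ≥ 1 let A_n, B_n, W_n be n×n Hermitian random matrices. Assume: (1) there exists a compactly supported probability measure μ_ω on ℝ such that almost surely μ_{W_n} converges in moments to μ_ω as n → ∞; (2) for every real t there exists a probability measure ψ(t;·) on ℝ such that almost surely μ_{A_n + tB_n} converges in moments to ψ(t;·) as n → ∞, and the supports of the measures ψ(t;·) are uniformly bounded for t in any compact subset of ℝ. Set 𝔹_{n,k} = I_k ⊗ A_n + W_k ⊗ B_n. Then almost surely both iterated limits lim_{n→∞} lim_{k→∞} μ_{𝔹_{n,k}} and lim_{k→∞} lim_{n→∞} μ_{𝔹_{n,k}} exist in the topology of weak convergence of probability measures and both equal the probability measure ν defined by ν(E) = ∫_ℝ ψ(t;E) μ_ω(dt) for Borel sets E ⊆ ℝ. -/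
open MeasureTheory ProbabilityTheory Matrix Filter Topology Kronecker
open scoped ENNReal NNReal

noncomputable section

instance matrixMeasurableSpace {m n α : Type*} [MeasurableSpace α] :
    MeasurableSpace (Matrix m n α) :=
  inferInstanceAs (MeasurableSpace (m → n → α))

/-- The (normalized) spectral measure of a matrix: the empirical eigenvalue
distribution if the matrix is Hermitian, the zero measure otherwise. -/
noncomputable def specMeasure {ι : Type*} [Fintype ι] [DecidableEq ι]
    (A : Matrix ι ι ℂ) : Measure ℝ :=
  if h : A.IsHermitian then
    ((Fintype.card ι : ℝ≥0∞))⁻¹ • ∑ i : ι, Measure.dirac (h.eigenvalues i)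
  else 0

/-- The normalized trace `tr_N(M) = trace(M)/N` (real part). -/
noncomputable def ntrace {ι : Type*} [Fintype ι] (M : Matrix ι ι ℂ) : ℝ :=
  (Matrix.trace M).re / (Fintype.card ι)

/-- Weak convergence of a sequence of measures on `ℝ`: convergence of the
integrals of all bounded continuous functions. -/
def WeakLim (μs : ℕ → Measure ℝ) (ν : Measure ℝ) : Prop :=
  ∀ f : BoundedContinuousFunction ℝ ℝ,
    Tendsto (fun n => ∫ x, f x ∂(μs n)) atTop (𝓝 (∫ x, f x ∂ν))

/-- Convergence in moments of a sequence of measures on `ℝ`. -/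
def MomentLim (μs : ℕ → Measure ℝ) (ν : Measure ℝ) : Prop :=
  ∀ m : ℕ, 1 ≤ m →
    Tendsto (fun n => ∫ x, x ^ m ∂(μs n)) atTop (𝓝 (∫ x, x ^ m ∂ν))

section MethodOfMoments

open Polynomial

/-- A bounded continuous function is approximated by a polynomial up to a small error on
`[-R, R]`, with an error growing like an arbitrarily high even power of `x / R` outside. -/
lemma BoundedContinuousFunction.exists_polynomial_near (f : BoundedContinuousFunction ℝ ℝ)
    {R ε : ℝ} (hR : 0 < R) (hε : 0 < ε) :
    ∃ (p : ℝ[X]) (C : ℝ) (d : ℕ), 0 ≤ C ∧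
      ∀ N, d ≤ N → ∀ x : ℝ, |f x - p.eval x| ≤ ε + C * (x / R) ^ (2 * N) := by
  obtain ⟨p, hp⟩ := exists_polynomial_near_of_continuousOn (-R) R f f.continuous.continuousOn ε hε
  have hC : 0 ≤ ‖f‖ + ∑ i ∈ Finset.range (p.natDegree + 1), |p.coeff i| * R ^ i := by positivity
  refine ⟨p, _, p.natDegree, hC, fun N hN x => ?_⟩
  have hpow : 0 ≤ (x / R) ^ (2 * N) := by rw [pow_mul]; positivity
  by_cases hx : |x| ≤ R
  · have := (hp x (abs_le.1 hx)).le
    rw [abs_sub_comm]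
    nlinarith [mul_nonneg hC hpow]
  · push Not at hx
    have hy : 1 ≤ |x| / R := (one_le_div hR).2 hx.le
    have hpow' : (x / R) ^ (2 * N) = (|x| / R) ^ (2 * N) := by
      rw [pow_mul, pow_mul, div_pow, div_pow |x|, sq_abs]
    have h1 : |f x| ≤ ‖f‖ * (|x| / R) ^ (2 * N) :=
      (f.norm_coe_le_norm x).trans (le_mul_of_one_le_right (norm_nonneg _) (one_le_pow₀ hy))
    have h2 : |p.eval x| ≤
        (∑ i ∈ Finset.range (p.natDegree + 1), |p.coeff i| * R ^ i) * (|x| / R) ^ (2 * N) := by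
      rw [eval_eq_sum_range, Finset.sum_mul]
      refine (Finset.abs_sum_le_sum_abs _ _).trans (Finset.sum_le_sum fun i hi => ?_)
      have hi' : i ≤ 2 * N := by have := Finset.mem_range.1 hi; omega
      have hxi : |x| ^ i = R ^ i * (|x| / R) ^ i := by
        rw [← mul_pow, mul_div_cancel₀ _ hR.ne']
      rw [abs_mul, abs_pow, hxi, mul_assoc]
      gcongr
    rw [hpow', add_mul]
    linarith [abs_sub (f x) (p.eval x)]

lemma integrable_pow_of_Icc_eq_one {ν : Measure ℝ} [IsProbabilityMeasure ν] {M : ℝ}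
    (hν : ν (Set.Icc (-M) M) = 1) (m : ℕ) : Integrable (fun x : ℝ => x ^ m) ν := by
  have hae : ∀ᵐ x ∂ν, x ∈ Set.Icc (-M) M := (prob_compl_eq_zero_iff measurableSet_Icc).2 hν
  refine Integrable.of_bound (by fun_prop) (M ^ m) (hae.mono fun x hx => ?_)
  rw [norm_pow]
  exact pow_le_pow_left₀ (norm_nonneg _) (abs_le.2 hx) m

lemma integral_eval_eq_sum {κ : Measure ℝ} (h : ∀ m : ℕ, Integrable (fun x : ℝ => x ^ m) κ)
    (p : ℝ[X]) :
    ∫ x, p.eval x ∂κ = ∑ i ∈ Finset.range (p.natDegree + 1), p.coeff i * ∫ x, x ^ i ∂κ := by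
  simp_rw [eval_eq_sum_range]
  rw [integral_finsetSum _ fun i _ => (h i).const_mul _]
  simp_rw [integral_const_mul]

lemma integrable_eval {κ : Measure ℝ} (h : ∀ m : ℕ, Integrable (fun x : ℝ => x ^ m) κ)
    (p : ℝ[X]) : Integrable (fun x => p.eval x) κ := by
  simp_rw [eval_eq_sum_range]
  exact integrable_finsetSum _ fun i _ => (h i).const_mul _

lemma abs_integral_sub_integral_eval_le {κ : Measure ℝ} [IsProbabilityMeasure κ]
    (h : ∀ m : ℕ, Integrable (fun x : ℝ => x ^ m) κ) (f : BoundedContinuousFunction ℝ ℝ)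
    (p : ℝ[X]) {R ε C : ℝ} {N : ℕ}
    (hp : ∀ x : ℝ, |f x - p.eval x| ≤ ε + C * (x / R) ^ (2 * N)) :
    |∫ x, f x ∂κ - ∫ x, p.eval x ∂κ| ≤ ε + C * ∫ x, (x / R) ^ (2 * N) ∂κ := by
  have hint : Integrable (fun x : ℝ => (x / R) ^ (2 * N)) κ := by
    simp_rw [div_pow]
    exact (h _).div_const _
  rw [← integral_sub (f.integrable κ) (integrable_eval h p)]
  refine (abs_integral_le_integral_abs).trans ?_
  refine (integral_mono ((f.integrable κ).sub (integrable_eval h p)).abs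
    ((integrable_const ε).add (hint.const_mul C)) hp).trans_eq ?_
  rw [integral_add' (integrable_const ε) (hint.const_mul C), integral_const_mul]
  simp

/-- Method of moments: convergence in moments to a compactly supported probability measure
implies convergence of the integrals of bounded continuous functions. -/
lemma tendsto_integral_of_tendsto_moments {ι : Type*} {l : Filter ι} {κ : ι → Measure ℝ}
    {ν : Measure ℝ} [IsProbabilityMeasure ν] {M : ℝ} (hM : 0 < M)
    (hν : ν (Set.Icc (-M) M) = 1) (hκ : ∀ᶠ i in l, IsProbabilityMeasure (κ i))
    (hint : ∀ i, ∀ m : ℕ, Integrable (fun x : ℝ => x ^ m) (κ i))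
    (hmom : ∀ m : ℕ, 1 ≤ m →
      Tendsto (fun i => ∫ x, x ^ m ∂(κ i)) l (𝓝 (∫ x, x ^ m ∂ν)))
    (f : BoundedContinuousFunction ℝ ℝ) :
    Tendsto (fun i => ∫ x, f x ∂(κ i)) l (𝓝 (∫ x, f x ∂ν)) := by
  have hνint := integrable_pow_of_Icc_eq_one hν
  have hmom' : ∀ m : ℕ, Tendsto (fun i => ∫ x, x ^ m ∂(κ i)) l (𝓝 (∫ x, x ^ m ∂ν)) := by
    intro m
    rcases Nat.eq_zero_or_pos m with rfl | hm
    · refine tendsto_const_nhds.congr' (hκ.mono fun i hi => ?_)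
      simp
    · exact hmom m hm
  rw [Metric.tendsto_nhds]
  intro ε hε
  obtain ⟨p, C, d, hC, hp⟩ :=
    f.exists_polynomial_near (R := M + 1) (ε := ε / 8) (by linarith) (by linarith)
  have hr : M / (M + 1) < 1 := (div_lt_one (by linarith)).2 (by linarith)
  have hr0 : 0 ≤ M / (M + 1) := by positivity
  have hlim : Tendsto (fun N : ℕ => C * (M / (M + 1)) ^ (2 * N)) atTop (𝓝 (C * 0)) :=
    ((tendsto_pow_atTop_nhds_zero_of_lt_one hr0 hr).comp
      (tendsto_id.const_mul_atTop' two_pos)).const_mul C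
  rw [mul_zero] at hlim
  obtain ⟨N, hN, hdN⟩ :=
    ((hlim.eventually (gt_mem_nhds (by linarith : 0 < ε / 8))).and (eventually_ge_atTop d)).exists
  have hνN : C * ∫ x, (x / (M + 1)) ^ (2 * N) ∂ν < ε / 8 := by
    refine lt_of_le_of_lt (mul_le_mul_of_nonneg_left ?_ hC) hN
    have hae : ∀ᵐ x ∂ν, x ∈ Set.Icc (-M) M := (prob_compl_eq_zero_iff measurableSet_Icc).2 hν
    have hi : Integrable (fun x : ℝ => (x / (M + 1)) ^ (2 * N)) ν := by
      simp_rw [div_pow]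
      exact (hνint _).div_const _
    refine (integral_mono_ae hi (integrable_const ((M / (M + 1)) ^ (2 * N)))
      (hae.mono fun x hx => ?_)).trans_eq (by simp)
    have : |x / (M + 1)| ≤ M / (M + 1) := by
      rw [abs_div, abs_of_pos (by linarith : 0 < M + 1)]
      gcongr
      exact abs_le.2 hx
    calc (x / (M + 1)) ^ (2 * N) = |x / (M + 1)| ^ (2 * N) := by rw [pow_mul, pow_mul, sq_abs]
      _ ≤ _ := pow_le_pow_left₀ (abs_nonneg _) this _
  have hκN : Tendsto (fun i => C * ∫ x, (x / (M + 1)) ^ (2 * N) ∂(κ i)) l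
      (𝓝 (C * ∫ x, (x / (M + 1)) ^ (2 * N) ∂ν)) := by
    simp_rw [div_pow, integral_div]
    exact ((hmom' _).div_const _).const_mul _
  have hκp : Tendsto (fun i => ∫ x, p.eval x ∂(κ i)) l (𝓝 (∫ x, p.eval x ∂ν)) := by
    simp_rw [integral_eval_eq_sum (hint _), integral_eval_eq_sum hνint]
    exact tendsto_finsetSum _ fun i _ => (hmom' i).const_mul _
  filter_upwards [hκ, hκN.eventually (gt_mem_nhds hνN),
    (Metric.tendsto_nhds.1 hκp) (ε / 8) (by linarith)] with i hi h1 h2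
  have e1 := abs_integral_sub_integral_eval_le (hint i) f p (hp N hdN)
  have e2 := abs_integral_sub_integral_eval_le hνint f p (hp N hdN)
  rw [Real.dist_eq] at h2 ⊢
  rw [abs_lt] at h2 ⊢
  rw [abs_le] at e1 e2
  constructor <;> linarith [h2.1, h2.2, e1.1, e1.2, e2.1, e2.2]

end MethodOfMoments

section Mixtures

/-- A family of measures with total mass at most one such that the integrals of bounded
continuous functions depend continuously on the parameter. -/
structure IsFellerFamily (κ : ℝ → Measure ℝ) : Prop where
  measure_univ_le : ∀ t, κ t Set.univ ≤ 1
  measurable : Measurable κ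
  continuous_integral : ∀ f : BoundedContinuousFunction ℝ ℝ, Continuous fun t => ∫ x, f x ∂(κ t)

lemma isFellerFamily_zero : IsFellerFamily fun _ => 0 where
  measure_univ_le _ := by simp
  measurable := measurable_const
  continuous_integral f := by simpa using continuous_const

lemma measurable_of_continuous_integral {κ : ℝ → Measure ℝ} [∀ t, IsProbabilityMeasure (κ t)]
    (h : ∀ f : BoundedContinuousFunction ℝ ℝ, Continuous fun t => ∫ x, f x ∂(κ t)) :
    Measurable κ := by
  refine .measure_of_isPiSystem_of_isProbabilityMeasure
    ((BorelSpace.measurable_eq (α := ℝ)).trans borel_eq_generateFrom_isClosed)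
    isPiSystem_isClosed fun F hF => ?_
  have key : Measurable fun t => (κ t).real F := by
    refine measurable_of_tendsto_metrizable (f := fun (n : ℕ) t =>
      ∫ x, (thickenedIndicator (δ := 1 / ((n : ℝ) + 1)) Nat.one_div_pos_of_nat F x : ℝ) ∂(κ t))
      (fun n => ?_) ?_
    · exact (h ((thickenedIndicator (δ := 1 / ((n : ℝ) + 1)) Nat.one_div_pos_of_nat F).comp
        _ NNReal.isometry_coe.lipschitz)).measurable
    · rw [tendsto_pi_nhds]
      exact fun t => tendsto_integral_thickenedIndicator_of_isClosed (κ t) hF _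
        tendsto_one_div_add_atTop_nhds_zero_nat
  simpa [Measure.real] using key.ennreal_ofReal

/-- A family of compactly supported probability measures with continuous moments. -/
lemma isFellerFamily_of_continuous_moments {κ : ℝ → Measure ℝ}
    [∀ t, IsProbabilityMeasure (κ t)] (hsupp : ∀ t, ∃ M : ℝ, 0 < M ∧ κ t (Set.Icc (-M) M) = 1)
    (hmom : ∀ m : ℕ, Continuous fun t => ∫ x, x ^ m ∂(κ t)) : IsFellerFamily κ := by
  have hcont (f : BoundedContinuousFunction ℝ ℝ) : Continuous fun t => ∫ x, f x ∂(κ t) := by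
    refine continuous_iff_continuousAt.2 fun t => ?_
    obtain ⟨M, hM, hκM⟩ := hsupp t
    refine tendsto_integral_of_tendsto_moments hM hκM (.of_forall inferInstance)
      (fun s m => ?_) (fun m _ => (hmom m).tendsto t) f
    obtain ⟨_, _, h⟩ := hsupp s
    exact integrable_pow_of_Icc_eq_one h m
  exact ⟨fun t => prob_le_one, measurable_of_continuous_integral hcont, hcont⟩

namespace IsFellerFamily

variable {κ : ℝ → Measure ℝ}

lemma norm_integral_le (h : IsFellerFamily κ) (f : BoundedContinuousFunction ℝ ℝ) (t : ℝ) :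
    ‖∫ x, f x ∂(κ t)‖ ≤ ‖f‖ := by
  have : IsFiniteMeasure (κ t) := ⟨(h.measure_univ_le t).trans_lt ENNReal.one_lt_top⟩
  refine (f.norm_integral_le_mul_norm (κ t)).trans (mul_le_of_le_one_left (norm_nonneg _) ?_)
  exact ENNReal.toReal_le_of_le_ofReal zero_le_one (by simpa using h.measure_univ_le t)

/-- Integration against a Feller family maps bounded continuous functions to bounded
continuous functions. -/
def integrate (h : IsFellerFamily κ) (f : BoundedContinuousFunction ℝ ℝ) :
    BoundedContinuousFunction ℝ ℝ :=
  .ofNormedAddCommGroup (fun t => ∫ x, f x ∂(κ t)) (h.continuous_integral f) ‖f‖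
    (h.norm_integral_le f)

lemma integral_bind (h : IsFellerFamily κ) (μ : Measure ℝ) [IsFiniteMeasure μ]
    (f : BoundedContinuousFunction ℝ ℝ) :
    ∫ x, f x ∂(μ.bind κ) = ∫ t, ∫ x, f x ∂(κ t) ∂μ := by
  let k : Kernel ℝ ℝ := ⟨κ, h.measurable⟩
  have : IsFiniteKernel k := ⟨1, ENNReal.one_lt_top, h.measure_univ_le⟩
  have hk : (k ∘ₖ Kernel.const Unit μ) () = μ.bind κ := by
    rw [Kernel.comp_apply, Kernel.const_apply]
    rfl
  rw [← hk, Kernel.integral_comp (f.integrable _), Kernel.const_apply]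
  rfl

/-- A mixture of a fixed Feller family depends weakly continuously on the mixing measure. -/
lemma weakLim_bind (h : IsFellerFamily κ) {μs : ℕ → Measure ℝ} {μ : Measure ℝ}
    [∀ n, IsFiniteMeasure (μs n)] [IsFiniteMeasure μ] (hμ : WeakLim μs μ) :
    WeakLim (fun n => (μs n).bind κ) (μ.bind κ) := fun f => by
  simp_rw [h.integral_bind]
  exact hμ (h.integrate f)

end IsFellerFamily

/-- A mixture with a fixed mixing measure depends weakly continuously on the Feller family. -/
lemma weakLim_bind_right {κs : ℕ → ℝ → Measure ℝ} {κ : ℝ → Measure ℝ}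
    (hs : ∀ n, IsFellerFamily (κs n)) (h : IsFellerFamily κ)
    (hlim : ∀ t, WeakLim (fun n => κs n t) (κ t)) (μ : Measure ℝ) [IsFiniteMeasure μ] :
    WeakLim (fun n => μ.bind (κs n)) (μ.bind κ) := fun f => by
  simp_rw [(hs _).integral_bind, h.integral_bind]
  exact tendsto_integral_of_dominated_convergence (fun _ => ‖f‖)
    (fun n => ((hs n).continuous_integral f).aestronglyMeasurable) (integrable_const _)
    (fun n => .of_forall fun t => (hs n).norm_integral_le f t)
    (.of_forall fun t => hlim t f)

end Mixtures

lemma isHermitian_add_smul {ι : Type*} {A B : Matrix ι ι ℂ} (hA : A.IsHermitian) (hB : B.IsHermitian)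
    (t : ℝ) : (A + (t : ℂ) • B).IsHermitian := by
  refine hA.add ?_
  rw [IsHermitian, conjTranspose_smul, hB.eq]
  simp

lemma isHermitian_one_kronecker_add_kronecker {ι ι' : Type*} [DecidableEq ι'] {A B : Matrix ι ι ℂ} {W : Matrix ι' ι' ℂ}
    (hA : A.IsHermitian) (hB : B.IsHermitian) (hW : W.IsHermitian) :
    ((1 : Matrix ι' ι' ℂ) ⊗ₖ A + W ⊗ₖ B).IsHermitian := by
  rw [IsHermitian, conjTranspose_add, conjTranspose_kronecker, conjTranspose_kronecker, hA.eq,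
    hB.eq, hW.eq, conjTranspose_one]

section SpectralMeasure

variable {ι ι' : Type*} [Fintype ι] [DecidableEq ι] [Fintype ι'] [DecidableEq ι']

lemma specMeasure_eq {M : Matrix ι ι ℂ} (hM : M.IsHermitian) :
    specMeasure M =
      ((Fintype.card ι : ℝ≥0∞))⁻¹ • ∑ i : ι, Measure.dirac (hM.eigenvalues i) := by
  rw [specMeasure, dif_pos hM]

lemma specMeasure_of_isEmpty [IsEmpty ι] (M : Matrix ι ι ℂ) : specMeasure M = 0 := by
  simp [specMeasure]

lemma isProbabilityMeasure_specMeasure [Nonempty ι] {M : Matrix ι ι ℂ} (hM : M.IsHermitian) :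
    IsProbabilityMeasure (specMeasure M) := by
  constructor
  rw [specMeasure_eq hM]
  simp [ENNReal.inv_mul_cancel]

instance (M : Matrix ι ι ℂ) : IsFiniteMeasure (specMeasure M) := by
  by_cases hM : M.IsHermitian
  · cases isEmpty_or_nonempty ι
    · rw [specMeasure_of_isEmpty]
      infer_instance
    · have := isProbabilityMeasure_specMeasure hM
      infer_instance
  · rw [specMeasure, dif_neg hM]
    infer_instance

lemma integrable_specMeasure (M : Matrix ι ι ℂ) (f : ℝ → ℝ) :
    Integrable f (specMeasure M) := by
  by_cases hM : M.IsHermitian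
  · cases isEmpty_or_nonempty ι
    · rw [specMeasure_of_isEmpty]
      exact integrable_zero_measure
    · rw [specMeasure_eq hM]
      refine Integrable.smul_measure ?_ (by simp)
      exact integrable_finsetSum_measure.2 fun i _ => integrable_dirac (by simp)
  · rw [specMeasure, dif_neg hM]
    exact integrable_zero_measure

lemma integral_specMeasure {M : Matrix ι ι ℂ} (hM : M.IsHermitian) (f : ℝ → ℝ) :
    ∫ x, f x ∂(specMeasure M) = (Fintype.card ι : ℝ)⁻¹ * ∑ i, f (hM.eigenvalues i) := by
  rw [specMeasure_eq hM, integral_smul_measure,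
    integral_finsetSum_measure fun i _ => integrable_dirac (by simp)]
  simp

lemma exists_specMeasure_Icc_eq_one [Nonempty ι] {M : Matrix ι ι ℂ} (hM : M.IsHermitian) :
    ∃ R : ℝ, 0 < R ∧ specMeasure M (Set.Icc (-R) R) = 1 := by
  refine ⟨1 + ∑ i, |hM.eigenvalues i|, by positivity, ?_⟩
  have hmem (i : ι) : hM.eigenvalues i ∈
      Set.Icc (-(1 + ∑ i, |hM.eigenvalues i|)) (1 + ∑ i, |hM.eigenvalues i|) := by
    have := Finset.single_le_sum (f := fun i => |hM.eigenvalues i|)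
      (fun i _ => abs_nonneg _) (Finset.mem_univ i)
    exact abs_le.1 (by linarith)
  rw [specMeasure_eq hM]
  simp only [Measure.smul_apply, Measure.finsetSum_apply, smul_eq_mul,
    Measure.dirac_apply_of_mem (hmem _)]
  simp [ENNReal.inv_mul_cancel]

lemma integral_specMeasure_eq_sum_roots {M : Matrix ι ι ℂ} (hM : M.IsHermitian) (f : ℝ → ℝ) :
    ∫ x, f x ∂(specMeasure M) =
      (Fintype.card ι : ℝ)⁻¹ * (M.charpoly.roots.map fun z => f z.re).sum := by
  rw [integral_specMeasure hM, hM.roots_charpoly_eq_eigenvalues, Multiset.map_map]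
  rfl

lemma integral_pow_specMeasure {M : Matrix ι ι ℂ} (hM : M.IsHermitian) (m : ℕ) :
    ∫ x, x ^ m ∂(specMeasure M) = ntrace (M ^ m) := by
  have h : (M ^ m).trace = ∑ i, ((hM.eigenvalues i ^ m : ℝ) : ℂ) := by
    conv_lhs => rw [hM.spectral_theorem, ← map_pow, Unitary.conjStarAlgAut_apply,
      Matrix.trace_mul_comm, ← mul_assoc]
    simp [Matrix.diagonal_pow, Matrix.trace_diagonal]
  rw [integral_specMeasure hM, ntrace, h, ← Complex.ofReal_sum, Complex.ofReal_re, div_eq_inv_mul]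

lemma Matrix.charpoly_blockDiagonal {R : Type*} [CommRing R] (M : ι' → Matrix ι ι R) :
    (blockDiagonal M).charpoly = ∏ i, (M i).charpoly := by
  have h : charmatrix (blockDiagonal M) = blockDiagonal fun i => charmatrix (M i) := by
    ext ⟨a, i⟩ ⟨b, j⟩
    by_cases hij : i = j <;> by_cases hab : a = b <;>
      simp [blockDiagonal_apply, hij, hab]
  simp_rw [Matrix.charpoly, h, det_blockDiagonal]

lemma charpoly_one_kronecker_add_kronecker {A B : Matrix ι ι ℂ} {W : Matrix ι' ι' ℂ}
    (hW : W.IsHermitian) :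
    ((1 : Matrix ι' ι' ℂ) ⊗ₖ A + W ⊗ₖ B).charpoly =
      ∏ i, (A + (hW.eigenvalues i : ℂ) • B).charpoly := by
  set U : Matrix ι' ι' ℂ := (hW.eigenvectorUnitary : Matrix ι' ι' ℂ)
  set D : Matrix ι' ι' ℂ := diagonal (RCLike.ofReal ∘ hW.eigenvalues) with hD
  have hUU : star U * U = 1 := Unitary.coe_star_mul_self _
  have hUU' : U * star U = 1 := Unitary.coe_mul_star_self _
  have hWeq : W = U * D * star U := by
    conv_lhs => rw [hW.spectral_theorem, Unitary.conjStarAlgAut_apply]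
  have hdiag : (1 : Matrix ι' ι' ℂ) ⊗ₖ A + D ⊗ₖ B =
      reindex (Equiv.prodComm _ _) (Equiv.prodComm _ _)
        (blockDiagonal fun i => A + (hW.eigenvalues i : ℂ) • B) := by
    rw [one_kronecker, hD, diagonal_kronecker, ← Pi.add_def, blockDiagonal_add]
    rfl
  have hconj : (1 : Matrix ι' ι' ℂ) ⊗ₖ A + W ⊗ₖ B =
      (U ⊗ₖ (1 : Matrix ι ι ℂ)) * ((1 : Matrix ι' ι' ℂ) ⊗ₖ A + D ⊗ₖ B) *
        (star U ⊗ₖ (1 : Matrix ι ι ℂ)) := by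
    rw [mul_add, add_mul]
    simp_rw [← mul_kronecker_mul]
    simp [hUU', ← hWeq]
  rw [hconj, Matrix.charpoly_mul_comm, ← mul_assoc, ← mul_kronecker_mul, hUU, one_mul,
    one_kronecker_one, one_mul, hdiag, charpoly_reindex, charpoly_blockDiagonal]

/-- The spectral measure of `I ⊗ A + W ⊗ B` is the mixture of the spectral measures of
`A + t B` along the spectral measure of `W`. -/
lemma integral_specMeasure_one_kronecker_add_kronecker {A B : Matrix ι ι ℂ}
    {W : Matrix ι' ι' ℂ} (hA : A.IsHermitian) (hB : B.IsHermitian) (hW : W.IsHermitian)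
    (f : ℝ → ℝ) :
    ∫ x, f x ∂(specMeasure ((1 : Matrix ι' ι' ℂ) ⊗ₖ A + W ⊗ₖ B)) =
      ∫ t, ∫ x, f x ∂(specMeasure (A + (t : ℂ) • B)) ∂(specMeasure W) := by
  rw [integral_specMeasure_eq_sum_roots (isHermitian_one_kronecker_add_kronecker hA hB hW),
    integral_specMeasure hW]
  simp_rw [integral_specMeasure_eq_sum_roots (isHermitian_add_smul hA hB _)]
  rw [charpoly_one_kronecker_add_kronecker hW, Polynomial.roots_prod _ _
    (Finset.prod_ne_zero_iff.2 fun i _ => (charpoly_monic _).ne_zero), Multiset.map_bind,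
    Multiset.sum_bind, ← Finset.mul_sum, ← mul_assoc, Fintype.card_prod, Nat.cast_mul, mul_inv]
  rfl

open Polynomial in
lemma exists_polynomial_ntrace_pow (A B : Matrix ι ι ℂ) (m : ℕ) :
    ∃ p : ℝ[X], p.natDegree ≤ m ∧ ∀ t : ℝ, ntrace ((A + (t : ℂ) • B) ^ m) = p.eval t := by
  have h : ∃ c : ℕ → Matrix ι ι ℂ, ∀ t : ℝ,
      (A + (t : ℂ) • B) ^ m = ∑ j ∈ Finset.range (m + 1), ((t ^ j : ℝ) : ℂ) • c j := by
    induction m with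
    | zero => exact ⟨fun _ => 1, fun t => by simp⟩
    | succ m ih =>
      obtain ⟨c, hc⟩ := ih
      refine ⟨fun j => (if j < m + 1 then c j * A else 0) +
        (if j = 0 then 0 else c (j - 1) * B), fun t => ?_⟩
      rw [pow_succ, hc t, mul_add]
      simp_rw [smul_add]
      rw [Finset.sum_add_distrib, Finset.sum_range_succ (n := m + 1),
        Finset.sum_range_succ' (n := m + 1)
          (f := fun j => ((t ^ j : ℝ) : ℂ) • if j = 0 then 0 else c (j - 1) * B)]
      congr 1
      · rw [Finset.sum_mul]
        simp only [lt_irrefl, if_false, smul_zero, add_zero]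
        refine Finset.sum_congr rfl fun j hj => ?_
        rw [if_pos (Finset.mem_range.1 hj), smul_mul_assoc]
      · rw [Finset.sum_mul]
        simp only [if_true, smul_zero, add_zero, Nat.succ_ne_zero, if_false, Nat.add_sub_cancel]
        refine Finset.sum_congr rfl fun j _ => ?_
        rw [smul_mul_smul_comm, pow_succ]
        push_cast
        rfl
  obtain ⟨c, hc⟩ := h
  refine ⟨∑ j ∈ Finset.range (m + 1), C (ntrace (c j)) * X ^ j, ?_, fun t => ?_⟩
  · refine natDegree_sum_le_of_forall_le _ _ fun j hj => ?_
    exact (natDegree_C_mul_X_pow_le _ _).trans (Nat.lt_succ_iff.1 (Finset.mem_range.1 hj))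
  · simp only [hc, ntrace, trace_sum, trace_smul, Complex.re_sum, smul_eq_mul,
      Complex.re_ofReal_mul, eval_finsetSum, eval_mul, eval_C, eval_pow, eval_X, Finset.sum_div]
    exact Finset.sum_congr rfl fun j _ => by ring

/-- The value at `t` of the `j`-th Lagrange basis polynomial for the nodes `0, …, m`. -/
def lagrangeWeight (m j : ℕ) (t : ℝ) : ℝ :=
  (Lagrange.basis (Finset.range (m + 1)) (fun i : ℕ => (i : ℝ)) j).eval t

lemma continuous_lagrangeWeight (m j : ℕ) : Continuous (lagrangeWeight m j) :=
  Polynomial.continuous _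

lemma integral_pow_specMeasure_eq_sum {A B : Matrix ι ι ℂ} (hA : A.IsHermitian)
    (hB : B.IsHermitian) (m : ℕ) (t : ℝ) :
    ∫ x, x ^ m ∂(specMeasure (A + (t : ℂ) • B)) = ∑ j ∈ Finset.range (m + 1),
      (∫ x, x ^ m ∂(specMeasure (A + ((j : ℝ) : ℂ) • B))) * lagrangeWeight m j t := by
  obtain ⟨p, hpm, hp⟩ := exists_polynomial_ntrace_pow A B m
  simp_rw [integral_pow_specMeasure (isHermitian_add_smul hA hB _), hp]
  have hdeg : p.degree < (Finset.range (m + 1)).card := by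
    rw [Finset.card_range]
    exact Polynomial.degree_le_natDegree.trans_lt (by exact_mod_cast Nat.lt_succ_of_le hpm)
  conv_lhs => rw [Lagrange.eq_interpolate (v := fun i : ℕ => (i : ℝ))
    Nat.cast_injective.injOn hdeg]
  simp [Lagrange.interpolate_apply, Polynomial.eval_finsetSum, lagrangeWeight]

lemma isFellerFamily_specMeasure {A B : Matrix ι ι ℂ} (hA : A.IsHermitian)
    (hB : B.IsHermitian) : IsFellerFamily fun t => specMeasure (A + (t : ℂ) • B) := by
  cases isEmpty_or_nonempty ι
  · simp_rw [specMeasure_of_isEmpty]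
    exact isFellerFamily_zero
  · have (t : ℝ) := isProbabilityMeasure_specMeasure (isHermitian_add_smul hA hB t)
    refine isFellerFamily_of_continuous_moments
      (fun t => exists_specMeasure_Icc_eq_one (isHermitian_add_smul hA hB t)) fun m => ?_
    exact (continuous_finsetSum _ fun j _ => (continuous_lagrangeWeight m j).const_mul _).congr
      fun t => (integral_pow_specMeasure_eq_sum hA hB m t).symm

end SpectralMeasure

lemma MomentLim.weakLim_specMeasure {M : (n : ℕ) → Matrix (Fin n) (Fin n) ℂ}
    (hM : ∀ n, (M n).IsHermitian) {ν : Measure ℝ} [IsProbabilityMeasure ν]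
    (hν : ∃ R : ℝ, 0 < R ∧ ν (Set.Icc (-R) R) = 1)
    (h : MomentLim (fun n => specMeasure (M n)) ν) : WeakLim (fun n => specMeasure (M n)) ν := by
  obtain ⟨R, hR, hνR⟩ := hν
  refine tendsto_integral_of_tendsto_moments hR hνR ?_ (fun n m => integrable_specMeasure _ _) h
  filter_upwards [eventually_gt_atTop 0] with n hn
  have : Nonempty (Fin n) := ⟨⟨0, hn⟩⟩
  exact isProbabilityMeasure_specMeasure (hM n)

/-- **Main Theorem.** Let `A_n, B_n, W_n` be `n × n` Hermitian
random matrices. Suppose that (1) almost surely the spectral measures of `W_n`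
converge in moments to a compactly supported probability measure `μω`, and (2)
for every real `t`, almost surely the spectral measures of `A_n + t B_n`
converge in moments to a probability measure `ψ t`, whose supports are
uniformly bounded for `t` in compact subsets of `ℝ`. Let
`𝔹_{n,k} = I_k ⊗ A_n + W_k ⊗ B_n` and let `ν` be the mixture
`ν E = ∫ ψ t E dμω(t)`. Then almost surely both iterated limits (first
`k → ∞` then `n → ∞`, and first `n → ∞` then `k → ∞`) of the spectral
measures of `𝔹_{n,k}` exist in the topology of weak convergence and both
equal `ν`. -/
theorem blockMatrix_limit_spectral_distribution
    {Ω : Type*} [MeasurableSpace Ω] (P : Measure Ω) [IsProbabilityMeasure P]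
    (A B W : (n : ℕ) → Ω → Matrix (Fin n) (Fin n) ℂ)
    (hAherm : ∀ n ω, (A n ω).IsHermitian)
    (hBherm : ∀ n ω, (B n ω).IsHermitian)
    (hWherm : ∀ n ω, (W n ω).IsHermitian)
    (μω : Measure ℝ) [IsProbabilityMeasure μω]
    (hμωcompact : ∃ M : ℝ, 0 < M ∧ μω (Set.Icc (-M) M) = 1)
    (hW : ∀ᵐ ω ∂P, MomentLim (fun n => specMeasure (W n ω)) μω)
    (ψ : ℝ → Measure ℝ) (hψprob : ∀ t, IsProbabilityMeasure (ψ t))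
    (hψ : ∀ t : ℝ, ∀ᵐ ω ∂P,
      MomentLim (fun n => specMeasure (A n ω + (t : ℂ) • B n ω)) (ψ t))
    (hψunif : ∀ C : Set ℝ, IsCompact C →
      ∃ M : ℝ, 0 < M ∧ ∀ t ∈ C, ψ t (Set.Icc (-M) M) = 1)
    (ν : Measure ℝ)
    (hν : ∀ E : Set ℝ, MeasurableSet E → ν E = ∫⁻ t, ψ t E ∂μω) :
    ∀ᵐ ω ∂P,
      (∃ νinner : ℕ → Measure ℝ,
        (∀ n : ℕ, WeakLim
          (fun k => specMeasure ((1 : Matrix (Fin k) (Fin k) ℂ) ⊗ₖ A n ω + W k ω ⊗ₖ B n ω))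
          (νinner n)) ∧
        WeakLim νinner ν) ∧
      (∃ νinner : ℕ → Measure ℝ,
        (∀ k : ℕ, WeakLim
          (fun n => specMeasure ((1 : Matrix (Fin k) (Fin k) ℂ) ⊗ₖ A n ω + W k ω ⊗ₖ B n ω))
          (νinner k)) ∧
        WeakLim νinner ν) := by
  have hψsupp (t : ℝ) : ∃ M : ℝ, 0 < M ∧ ψ t (Set.Icc (-M) M) = 1 := by
    obtain ⟨M, hM, h⟩ := hψunif {t} isCompact_singleton
    exact ⟨M, hM, h t rfl⟩
  have hinterp {ω : Ω} (hω : ∀ j : ℕ, MomentLim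
      (fun n => specMeasure (A n ω + ((j : ℝ) : ℂ) • B n ω)) (ψ j)) (t : ℝ) {m : ℕ} (hm : 1 ≤ m) :
      Tendsto (fun n => ∫ x, x ^ m ∂(specMeasure (A n ω + (t : ℂ) • B n ω))) atTop
        (𝓝 (∑ j ∈ Finset.range (m + 1), (∫ x, x ^ m ∂(ψ j)) * lagrangeWeight m j t)) := by
    simp_rw [integral_pow_specMeasure_eq_sum (hAherm _ ω) (hBherm _ ω) m t]
    exact tendsto_finsetSum _ fun j _ => (hω j m hm).mul_const _
  have hgrid : ∀ᵐ ω ∂P, ∀ j : ℕ, MomentLim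
      (fun n => specMeasure (A n ω + ((j : ℝ) : ℂ) • B n ω)) (ψ j) :=
    ae_all_iff.2 fun j => hψ j
  have hψmom (t : ℝ) {m : ℕ} (hm : 1 ≤ m) : ∫ x, x ^ m ∂(ψ t) =
      ∑ j ∈ Finset.range (m + 1), (∫ x, x ^ m ∂(ψ j)) * lagrangeWeight m j t := by
    obtain ⟨ω, hω, hωt⟩ := (hgrid.and (hψ t)).exists
    exact tendsto_nhds_unique (hωt m hm) (hinterp hω t hm)
  have hψfeller : IsFellerFamily ψ := by
    refine isFellerFamily_of_continuous_moments hψsupp fun m => ?_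
    rcases Nat.eq_zero_or_pos m with rfl | hm
    · simpa using continuous_const
    · exact (continuous_finsetSum _ fun j _ => (continuous_lagrangeWeight m j).const_mul _).congr
        fun t => (hψmom t hm).symm
  have hνbind : ν = μω.bind ψ := by
    ext E hE
    rw [hν E hE, Measure.bind_apply hE hψfeller.measurable.aemeasurable]
  rw [hνbind]
  filter_upwards [hW, hgrid] with ω hWω hω
  have hfeller (n : ℕ) := isFellerFamily_specMeasure (hAherm n ω) (hBherm n ω)
  have hlimW := hWω.weakLim_specMeasure (fun n => hWherm n ω) hμωcompact
  have hlimψ (t : ℝ) : WeakLim (fun n => specMeasure (A n ω + (t : ℂ) • B n ω)) (ψ t) := by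
    refine MomentLim.weakLim_specMeasure
      (fun n => isHermitian_add_smul (hAherm n ω) (hBherm n ω) t) (hψsupp t) fun m hm => ?_
    rw [hψmom t hm]
    exact hinterp hω t hm
  have hmix (n k : ℕ) (f : BoundedContinuousFunction ℝ ℝ) :
      ∫ x, f x ∂(specMeasure ((1 : Matrix (Fin k) (Fin k) ℂ) ⊗ₖ A n ω + W k ω ⊗ₖ B n ω)) =
        ∫ x, f x ∂((specMeasure (W k ω)).bind
          fun t => specMeasure (A n ω + (t : ℂ) • B n ω)) := by
    rw [(hfeller n).integral_bind, integral_specMeasure_one_kronecker_add_kronecker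
      (hAherm n ω) (hBherm n ω) (hWherm k ω)]
  refine ⟨⟨fun n => μω.bind fun t => specMeasure (A n ω + (t : ℂ) • B n ω), fun n f => ?_,
      weakLim_bind_right hfeller hψfeller hlimψ μω⟩,
    ⟨fun k => (specMeasure (W k ω)).bind ψ, fun k f => ?_, hψfeller.weakLim_bind hlimW⟩⟩
  · simp_rw [hmix]
    exact (hfeller n).weakLim_bind hlimW f
  · simp_rw [hmix]
    exact weakLim_bind_right hfeller hψfeller hlimψ _ f
end
end

section
/- Fix n ≥ 1 and let A_n, B_n be n×n Hermitian random matrices. Let (W_k)_{k≥1} be a sequence of k×k Hermitian random matrices such that almost surely μ_{W_k} converges in moments to a compactly supported probability measure μ_ω as k → ∞. Set 𝔹_{n,k} = I_k ⊗ A_n + W_k ⊗ B_n. Then almost surely, for every integer m ≥ 1, lim_{k→∞} tr_{nk}(𝔹_{n,k}^m) = ∫_ℝ tr_n((A_n + tB_n)^m) μ_ω(dt). -/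
open MeasureTheory ProbabilityTheory Matrix Filter Topology Kronecker
open scoped ENNReal NNReal

noncomputable section

/-- Powers of a degree-one pencil expand into powers of the variable, with coefficients common to
the scalar pencil `A + tB` and to its amplifications `I ⊗ A + W ⊗ B`. -/
theorem exists_pencil_pow_expansion {n : ℕ} (A B : Matrix (Fin n) (Fin n) ℂ) (m : ℕ) :
    ∃ c : ℕ → Matrix (Fin n) (Fin n) ℂ,
      (∀ (k : ℕ) (W : Matrix (Fin k) (Fin k) ℂ),
        ((1 : Matrix (Fin k) (Fin k) ℂ) ⊗ₖ A + W ⊗ₖ B) ^ m =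
          ∑ j ∈ Finset.range (m + 1), (W ^ j) ⊗ₖ c j) ∧
      ∀ t : ℂ, (A + t • B) ^ m = ∑ j ∈ Finset.range (m + 1), t ^ j • c j := by
  induction m with
  | zero => exact ⟨fun _ => 1, by simp, by simp⟩
  | succ m ih =>
    obtain ⟨c, hW, ht⟩ := ih
    let a : ℕ → Matrix (Fin n) (Fin n) ℂ := fun j => if j < m + 1 then c j * A else 0
    let b : ℕ → Matrix (Fin n) (Fin n) ℂ := fun j => if j = 0 then 0 else c (j - 1) * B
    refine ⟨fun j => a j + b j, fun k W => ?_, fun t => ?_⟩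
    · simp only [kronecker_add, Finset.sum_add_distrib]
      rw [Finset.sum_range_succ _ (m + 1),
        Finset.sum_range_succ' (fun j => (W ^ j) ⊗ₖ b j), pow_succ, hW, mul_add]
      simp only [Finset.sum_mul, ← mul_kronecker_mul, mul_one, ← pow_succ]
      have h : ∑ j ∈ Finset.range (m + 1), (W ^ j) ⊗ₖ a j =
          ∑ j ∈ Finset.range (m + 1), (W ^ j) ⊗ₖ (c j * A) :=
        Finset.sum_congr rfl fun j hj => by simp only [a, if_pos (Finset.mem_range.mp hj)]
      rw [h]
      simp [a, b]
    · simp only [smul_add, Finset.sum_add_distrib]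
      rw [Finset.sum_range_succ _ (m + 1),
        Finset.sum_range_succ' (fun j => t ^ j • b j), pow_succ, ht, mul_add]
      simp only [Finset.sum_mul, smul_mul_assoc]
      have h : ∑ j ∈ Finset.range (m + 1), t ^ j • a j =
          ∑ j ∈ Finset.range (m + 1), t ^ j • (c j * A) :=
        Finset.sum_congr rfl fun j hj => by simp only [a, if_pos (Finset.mem_range.mp hj)]
      rw [h]
      simp [a, b, pow_succ, mul_smul]

theorem ntrace_sum {ι κ : Type*} [Fintype ι] (s : Finset κ) (M : κ → Matrix ι ι ℂ) :
    ntrace (∑ j ∈ s, M j) = ∑ j ∈ s, ntrace (M j) := by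
  simp [ntrace, Matrix.trace_sum, Finset.sum_div]

theorem ntrace_ofReal_smul {ι : Type*} [Fintype ι] (r : ℝ) (M : Matrix ι ι ℂ) :
    ntrace ((r : ℂ) • M) = r * ntrace M := by
  simp [ntrace, Matrix.trace_smul, mul_div_assoc]

theorem Matrix.IsHermitian.trace_pow_eq_sum_eigenvalues {ι : Type*} [Fintype ι] [DecidableEq ι]
    {M : Matrix ι ι ℂ} (h : M.IsHermitian) (j : ℕ) :
    (M ^ j).trace = ((∑ i, h.eigenvalues i ^ j : ℝ) : ℂ) := by
  conv_lhs => rw [h.spectral_theorem]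
  rw [← map_pow, Unitary.conjStarAlgAut_apply, Matrix.trace_mul_cycle]
  simp [Matrix.diagonal_pow, Matrix.trace_diagonal]

theorem Matrix.IsHermitian.integral_pow_specMeasure {ι : Type*} [Fintype ι] [DecidableEq ι]
    {M : Matrix ι ι ℂ} (h : M.IsHermitian) (j : ℕ) :
    ∫ x, x ^ j ∂(specMeasure M) = (∑ i, h.eigenvalues i ^ j) / Fintype.card ι := by
  rw [specMeasure, dif_pos h, integral_smul_measure,
    integral_finsetSum_measure fun i _ => integrable_dirac (by simp)]
  simp [div_eq_inv_mul]

theorem Matrix.IsHermitian.ntrace_pow_kronecker {ι κ : Type*} [Fintype ι] [DecidableEq ι]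
    [Fintype κ] {M : Matrix ι ι ℂ} (h : M.IsHermitian) (j : ℕ) (C : Matrix κ κ ℂ) :
    ntrace ((M ^ j) ⊗ₖ C) = (∫ x, x ^ j ∂(specMeasure M)) * ntrace C := by
  rw [h.integral_pow_specMeasure, ntrace, Matrix.trace_kronecker, h.trace_pow_eq_sum_eigenvalues,
    Complex.re_ofReal_mul, Fintype.card_prod, Nat.cast_mul, ntrace, div_mul_div_comm]

theorem integrable_pow_of_measure_Icc_eq_one {μ : Measure ℝ} [IsProbabilityMeasure μ] {M : ℝ}
    (hM : μ (Set.Icc (-M) M) = 1) (j : ℕ) : Integrable (fun x : ℝ => x ^ j) μ := by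
  refine Integrable.of_bound (by fun_prop) (M ^ j) ?_
  have h : ∀ᵐ x ∂μ, x ∈ Set.Icc (-M) M :=
    (mem_ae_iff_prob_eq_one measurableSet_Icc).mpr hM
  filter_upwards [h] with x hx
  rw [norm_pow]
  exact pow_le_pow_left₀ (norm_nonneg x) (abs_le.mpr hx) j

theorem MomentLim.tendsto_integral_pow {W : (k : ℕ) → Matrix (Fin k) (Fin k) ℂ}
    (hW : ∀ k, (W k).IsHermitian) {μ : Measure ℝ} [IsProbabilityMeasure μ]
    (h : MomentLim (fun k => specMeasure (W k)) μ) (j : ℕ) :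
    Tendsto (fun k => ∫ x, x ^ j ∂(specMeasure (W k))) atTop (𝓝 (∫ x, x ^ j ∂μ)) := by
  rcases Nat.eq_zero_or_pos j with rfl | hj
  · refine tendsto_nhds_of_eventually_eq ?_
    filter_upwards [eventually_ge_atTop 1] with k hk
    have : (k : ℝ) ≠ 0 := by positivity
    rw [(hW k).integral_pow_specMeasure]
    simp [this]
  · exact h j hj

/-- Fix `n ≥ 1` and Hermitian random matrices `A, B` of order
`n`. If `W_k` are Hermitian random matrices of order `k` whose spectral
measures converge in moments, almost surely, to a compactly supported
probability measure `μω`, then almost surely, for every `m ≥ 1`,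
`tr_{nk}((I_k ⊗ A + W_k ⊗ B)^m) → ∫ tr_n((A + tB)^m) dμω(t)` as `k → ∞`. -/
theorem trace_limit_in_k
    {Ω : Type*} [MeasurableSpace Ω] (P : Measure Ω) [IsProbabilityMeasure P]
    {n : ℕ} (hn : 1 ≤ n)
    (A B : Ω → Matrix (Fin n) (Fin n) ℂ)
    (hAherm : ∀ ω, (A ω).IsHermitian) (hBherm : ∀ ω, (B ω).IsHermitian)
    (W : (k : ℕ) → Ω → Matrix (Fin k) (Fin k) ℂ)
    (hWherm : ∀ k ω, (W k ω).IsHermitian)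
    (μω : Measure ℝ) [IsProbabilityMeasure μω]
    (hμωcompact : ∃ M : ℝ, 0 < M ∧ μω (Set.Icc (-M) M) = 1)
    (hW : ∀ᵐ ω ∂P, MomentLim (fun k => specMeasure (W k ω)) μω) :
    ∀ᵐ ω ∂P, ∀ m : ℕ, 1 ≤ m →
      Tendsto
        (fun k => ntrace (((1 : Matrix (Fin k) (Fin k) ℂ) ⊗ₖ A ω + W k ω ⊗ₖ B ω) ^ m))
        atTop
        (𝓝 (∫ t, ntrace ((A ω + (t : ℂ) • B ω) ^ m) ∂μω)) := by
  filter_upwards [hW] with ω hω m _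
  obtain ⟨c, hc, hct⟩ := exists_pencil_pow_expansion (A ω) (B ω) m
  obtain ⟨M, _, hM⟩ := hμωcompact
  have hlim : ∫ t, ntrace ((A ω + (t : ℂ) • B ω) ^ m) ∂μω =
      ∑ j ∈ Finset.range (m + 1), (∫ t, t ^ j ∂μω) * ntrace (c j) := by
    simp only [hct, ntrace_sum, ← Complex.ofReal_pow, ntrace_ofReal_smul]
    rw [integral_finsetSum _ fun j _ =>
      (integrable_pow_of_measure_Icc_eq_one hM j).mul_const _]
    simp only [integral_mul_const]
  simp only [hlim, hc, ntrace_sum, (hWherm _ ω).ntrace_pow_kronecker]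
  exact tendsto_finsetSum _ fun j _ =>
    (hω.tendsto_integral_pow (fun k => hWherm k ω) j).mul_const _
end
end

section
/- Fix t > 0 and consider the quartic equation in x: 4 + 27t² − 6tx − x² − 6t²x² + 2tx³ + 4t³x³ − t²x⁴ = 0. Then: (i) this equation has exactly two real roots s₁(t) < s₂(t), and its other two roots are non-real complex conjugates; (ii) the left-hand side is positive at x = 0, so s₁(t) < 0 < s₂(t) is not asserted, but 0 lies strictly between consecutive sign changes, i.e. the quartic is positive at x = 0; (iii) for every compact set C ⊂ (0,∞) there exists M > 0 such that |s₁(t)| ≤ M and |s₂(t)| ≤ M for all t ∈ C, and s₁ and s₂ depend continuously on t. -/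
/-- The quartic `4 + 27t² - 6tx - x² - 6t²x² + 2tx³ + 4t³x³ - t²x⁴`
(as a function of a real variable `x`, with real parameter `t`). -/
noncomputable def quartReal (t x : ℝ) : ℝ :=
  4 + 27 * t ^ 2 - 6 * t * x - x ^ 2 - 6 * t ^ 2 * x ^ 2
    + 2 * t * x ^ 3 + 4 * t ^ 3 * x ^ 3 - t ^ 2 * x ^ 4

/-- The same quartic viewed as a function of a complex variable `x`. -/
noncomputable def quartComplex (t : ℝ) (x : ℂ) : ℂ :=
  4 + 27 * (t : ℂ) ^ 2 - 6 * (t : ℂ) * x - x ^ 2 - 6 * (t : ℂ) ^ 2 * x ^ 2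
    + 2 * (t : ℂ) * x ^ 3 + 4 * (t : ℂ) ^ 3 * x ^ 3 - (t : ℂ) ^ 2 * x ^ 4

/-- The quartic splits into two quadratics with explicit coefficients in terms of `m`, `n`, where
`n ^ 2 = m ^ 2 + 1` and `m * n ^ 2 = 2 * t ^ 2`. -/
lemma quartic_eq_mul_quadratics {K : Type*} [Field K] {t m n : K} (ht : 2 * t ≠ 0) (hn : n ≠ 0)
    (hmn : n ^ 2 = m ^ 2 + 1) (hmt : m * n ^ 2 = 2 * t ^ 2) (x : K) :
    4 + 27 * t ^ 2 - 6 * t * x - x ^ 2 - 6 * t ^ 2 * x ^ 2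
        + 2 * t * x ^ 3 + 4 * t ^ 3 * x ^ 3 - t ^ 2 * x ^ 4 =
      -t ^ 2 * ((x - (n ^ 3 + m * n ^ 2 - 2 * n + 1) / (2 * t)) ^ 2
          - (n - m / 2) * (1 / n + m + n) ^ 2) *
        ((x - (-n ^ 3 + m * n ^ 2 + 2 * n + 1) / (2 * t)) ^ 2
          + (n + m / 2) * (1 / n + n - m) ^ 2) := by
  have h2 : (2 : K) ≠ 0 := left_ne_zero_of_mul ht
  have ht0 : t ≠ 0 := right_ne_zero_of_mul ht
  have key (X : K) : 64 * (m * n ^ 2) + 216 * (m * n ^ 2) ^ 2 - 48 * m * n ^ 2 * X - 8 * X ^ 2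
      - 24 * m * n ^ 2 * X ^ 2 + 8 * X ^ 3 + 8 * m * n ^ 2 * X ^ 3 - 2 * X ^ 4 =
      -2 * ((X - (n ^ 3 + m * n ^ 2 - 2 * n + 1)) ^ 2 - (2 * n - m) * m * (1 + m * n + n ^ 2) ^ 2)
        * ((X - (-n ^ 3 + m * n ^ 2 + 2 * n + 1)) ^ 2
          + (2 * n + m) * m * (1 + n ^ 2 - m * n) ^ 2) := by
    grind
  have hleft : (2 * t) ^ 2 * ((x - (n ^ 3 + m * n ^ 2 - 2 * n + 1) / (2 * t)) ^ 2
      - (n - m / 2) * (1 / n + m + n) ^ 2) =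
      (2 * t * x - (n ^ 3 + m * n ^ 2 - 2 * n + 1)) ^ 2
        - (2 * n - m) * m * (1 + m * n + n ^ 2) ^ 2 := by
    field_simp
    linear_combination (2 * n - m) * (1 + m * n + n ^ 2) ^ 2 * hmt
  have hright : (2 * t) ^ 2 * ((x - (-n ^ 3 + m * n ^ 2 + 2 * n + 1) / (2 * t)) ^ 2
      + (n + m / 2) * (1 / n + n - m) ^ 2) =
      (2 * t * x - (-n ^ 3 + m * n ^ 2 + 2 * n + 1)) ^ 2
        + (2 * n + m) * m * (1 + n ^ 2 - m * n) ^ 2 := by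
    field_simp
    linear_combination -(2 * n + m) * (1 + n ^ 2 - m * n) ^ 2 * hmt
  have hX := key (2 * t * x)
  rw [← hleft, ← hright] at hX
  have h32 : (32 * t ^ 2 : K) ≠ 0 := by
    have : (32 * t ^ 2 : K) = 2 ^ 5 * t ^ 2 := by norm_num
    rw [this]
    exact mul_ne_zero (pow_ne_zero _ h2) (pow_ne_zero _ ht0)
  apply mul_left_cancel₀ h32
  linear_combination hX - (64 + 216 * (m * n ^ 2 + 2 * t ^ 2) - 48 * (2 * t * x)
    - 24 * (2 * t * x) ^ 2 + 8 * (2 * t * x) ^ 3) * hmt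

/-- The real cubic `m ^ 3 + m = s` has a solution depending continuously on `s`. -/
lemma exists_continuous_cube_add_self_eq :
    ∃ m : ℝ → ℝ, Continuous m ∧ ∀ s, m s ^ 3 + m s = s := by
  have hmono : StrictMono fun m : ℝ => m ^ 3 + m :=
    (Odd.strictMono_pow (by decide)).add strictMono_id
  have hsurj : Function.Surjective fun m : ℝ => m ^ 3 + m := by
    refine Continuous.surjective (by fun_prop) ?_ ?_
    · exact (Filter.tendsto_pow_atTop (by norm_num)).atTop_add_atTop Filter.tendsto_id
    · refine Filter.tendsto_atBot_mono' _ ?_ Filter.tendsto_id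
      filter_upwards [Filter.eventually_le_atBot 0] with m hm
      have : m ^ 3 ≤ 0 := Odd.pow_nonpos (by decide) hm
      simpa using this
  let e := hmono.orderIsoOfSurjective _ hsurj
  exact ⟨e.symm, e.symm.continuous, fun s => e.apply_symm_apply s⟩

/-- For `t > 0` the quartic is `-t²` times a quadratic with real roots `p t ± u t` and one with
roots `q t ± i v t`, where `p` and `u` are continuous in `t`. -/
lemma exists_quartComplex_eq_mul :
    ∃ p u q v : ℝ → ℝ, ContinuousOn p (Set.Ioi 0) ∧ ContinuousOn u (Set.Ioi 0) ∧
      ∀ t : ℝ, 0 < t → 0 < u t ∧ 0 < v t ∧ ∀ z : ℂ, quartComplex t z =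
        -(t : ℂ) ^ 2 * ((z - p t) ^ 2 - (u t : ℂ) ^ 2) * ((z - q t) ^ 2 + (v t : ℂ) ^ 2) := by
  obtain ⟨f, hf, hfs⟩ := exists_continuous_cube_add_self_eq
  set m : ℝ → ℝ := fun t => f (2 * t ^ 2)
  set n : ℝ → ℝ := fun t => √(m t ^ 2 + 1)
  have hmc : Continuous m := by fun_prop
  have hnc : Continuous n := by fun_prop
  have hnpos (t : ℝ) : 0 < n t := Real.sqrt_pos.2 (by positivity)
  have hnsq (t : ℝ) : n t ^ 2 = m t ^ 2 + 1 := Real.sq_sqrt (by positivity)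
  have hlt (t : ℝ) : m t < n t := by nlinarith [hnpos t, hnsq t]
  refine ⟨fun t => (n t ^ 3 + m t * n t ^ 2 - 2 * n t + 1) / (2 * t),
    fun t => √(n t - m t / 2) * (1 / n t + m t + n t),
    fun t => (-n t ^ 3 + m t * n t ^ 2 + 2 * n t + 1) / (2 * t),
    fun t => √(n t + m t / 2) * (1 / n t + n t - m t), ?_, ?_, fun t ht => ?_⟩
  · exact ContinuousOn.div (by fun_prop) (by fun_prop)
      fun t (ht : 0 < t) => (by positivity : 2 * t ≠ 0)
  · have hinv : Continuous fun t => 1 / n t :=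
      continuous_const.div hnc fun t => (hnpos t).ne'
    fun_prop
  · have hmt : m t ^ 3 + m t = 2 * t ^ 2 := hfs _
    have hmpos : 0 < m t := by
      by_contra! h
      nlinarith [sq_nonneg (m t), pow_pos ht 2]
    have hl := hlt t
    have hnp := hnpos t
    have hninv : 0 < 1 / n t := by positivity
    have hu : 0 < n t - m t / 2 := by linarith
    have hv : 0 < n t + m t / 2 := by linarith
    refine ⟨mul_pos (Real.sqrt_pos.2 hu) (by positivity),
      mul_pos (Real.sqrt_pos.2 hv) (by linarith), fun z => ?_⟩
    have hu2 : ((√(n t - m t / 2) : ℝ) : ℂ) ^ 2 = (n t : ℂ) - m t / 2 := by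
      exact_mod_cast congrArg ((↑) : ℝ → ℂ) (Real.sq_sqrt hu.le)
    have hv2 : ((√(n t + m t / 2) : ℝ) : ℂ) ^ 2 = (n t : ℂ) + m t / 2 := by
      exact_mod_cast congrArg ((↑) : ℝ → ℂ) (Real.sq_sqrt hv.le)
    have hmt' : m t * n t ^ 2 = 2 * t ^ 2 := by rw [hnsq]; linarith
    have hfactor := quartic_eq_mul_quadratics (t := (t : ℂ)) (m := (m t : ℂ)) (n := (n t : ℂ))
      (by exact_mod_cast (by positivity : 2 * t ≠ 0)) (by exact_mod_cast hnp.ne')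
      (by exact_mod_cast hnsq t) (by exact_mod_cast hmt') z
    rw [quartComplex, hfactor]
    push_cast
    rw [mul_pow, mul_pow, hu2, hv2]

/-- For every `t > 0` the quartic
`4 + 27t² - 6tx - x² - 6t²x² + 2tx³ + 4t³x³ - t²x⁴ = 0` has exactly two real
roots `s₁(t) < s₂(t)` and a pair of non-real complex conjugate roots; its
left-hand side is positive at `x = 0`; and the real roots can be chosen as
continuous functions of `t` on `(0, ∞)`, uniformly bounded on every compact
subset of `(0, ∞)`. -/
theorem quartic_root_structure :
    (∀ t : ℝ, 0 < t →
      ∃ s₁ s₂ : ℝ, s₁ < s₂ ∧ quartReal t s₁ = 0 ∧ quartReal t s₂ = 0 ∧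
        (∀ x : ℝ, quartReal t x = 0 → x = s₁ ∨ x = s₂) ∧
        ∃ w : ℂ, w.im ≠ 0 ∧ quartComplex t w = 0 ∧
          quartComplex t ((starRingEnd ℂ) w) = 0 ∧
          ∀ z : ℂ, quartComplex t z = 0 →
            z = (s₁ : ℂ) ∨ z = (s₂ : ℂ) ∨ z = w ∨ z = (starRingEnd ℂ) w) ∧
    (∀ t : ℝ, 0 < t → 0 < quartReal t 0) ∧
    (∃ s₁ s₂ : ℝ → ℝ,
      ContinuousOn s₁ (Set.Ioi (0 : ℝ)) ∧ ContinuousOn s₂ (Set.Ioi (0 : ℝ)) ∧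
      (∀ t : ℝ, 0 < t →
        s₁ t < s₂ t ∧ quartReal t (s₁ t) = 0 ∧ quartReal t (s₂ t) = 0) ∧
      ∀ C : Set ℝ, C ⊆ Set.Ioi (0 : ℝ) → IsCompact C →
        ∃ M : ℝ, 0 < M ∧ ∀ t ∈ C, |s₁ t| ≤ M ∧ |s₂ t| ≤ M) := by
  obtain ⟨p, u, q, v, hp, hu, h⟩ := exists_quartComplex_eq_mul
  have hreal (t x : ℝ) (ht : 0 < t) : quartReal t x =
      -t ^ 2 * ((x - p t) ^ 2 - u t ^ 2) * ((x - q t) ^ 2 + v t ^ 2) := by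
    have hx := (h t ht).2.2 x
    rw [quartComplex] at hx
    rw [quartReal]
    exact_mod_cast hx
  have hroot₁ (t : ℝ) (ht : 0 < t) : quartReal t (p t - u t) = 0 := by
    rw [hreal t _ ht]; ring
  have hroot₂ (t : ℝ) (ht : 0 < t) : quartReal t (p t + u t) = 0 := by
    rw [hreal t _ ht]; ring
  refine ⟨fun t ht => ?_, fun t ht => ?_, fun t => p t - u t, fun t => p t + u t,
    hp.sub hu, hp.add hu, fun t ht => ⟨by linarith [(h t ht).1], hroot₁ t ht, hroot₂ t ht⟩,
    fun C hC hCc => ?_⟩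
  · obtain ⟨hut, hvt, hz⟩ := h t ht
    have hcomplex (z : ℂ) (h0 : quartComplex t z = 0) :
        (z = ((p t - u t : ℝ) : ℂ) ∨ z = ((p t + u t : ℝ) : ℂ)) ∨
          z = ⟨q t, v t⟩ ∨ z = (starRingEnd ℂ) ⟨q t, v t⟩ := by
      have ht' : -(t : ℂ) ^ 2 ≠ 0 := neg_ne_zero.2 (pow_ne_zero _ (by exact_mod_cast ht.ne'))
      rw [hz, mul_eq_zero, mul_eq_zero, or_iff_right ht'] at h0
      refine h0.imp (fun h0 => ?_) fun h0 => ?_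
      · have : (z - (p t - u t : ℝ)) * (z - (p t + u t : ℝ)) = 0 := by
          push_cast; linear_combination h0
        simpa only [mul_eq_zero, sub_eq_zero] using this
      · have : (z - ⟨q t, v t⟩) * (z - (starRingEnd ℂ) ⟨q t, v t⟩) = 0 := by
          simp only [Complex.mk_eq_add_mul_I, map_add, map_mul, Complex.conj_ofReal,
            Complex.conj_I]
          linear_combination h0 - (v t : ℂ) ^ 2 * Complex.I_sq
        simpa only [mul_eq_zero, sub_eq_zero] using this
    refine ⟨p t - u t, p t + u t, by linarith, hroot₁ t ht, hroot₂ t ht, fun x hx => ?_,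
      ⟨q t, v t⟩, hvt.ne', ?_, ?_, fun z h0 => or_assoc.1 (hcomplex z h0)⟩
    · have hpos : (x - q t) ^ 2 + v t ^ 2 ≠ 0 := by positivity
      rw [hreal t x ht, mul_eq_zero, or_iff_left hpos, mul_eq_zero,
        or_iff_right (by simpa using ht.ne')] at hx
      have : (x - (p t - u t)) * (x - (p t + u t)) = 0 := by linear_combination hx
      simpa only [mul_eq_zero, sub_eq_zero] using this
    · rw [hz, Complex.mk_eq_add_mul_I, add_sub_cancel_left, mul_pow, Complex.I_sq]
      ring
    · rw [hz, Complex.mk_eq_add_mul_I]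
      simp only [map_add, map_mul, Complex.conj_ofReal, Complex.conj_I]
      rw [add_sub_cancel_left, mul_pow, neg_sq, Complex.I_sq]
      ring
  · have : quartReal t 0 = 4 + 27 * t ^ 2 := by rw [quartReal]; ring
    rw [this]
    positivity
  · obtain ⟨M₁, hM₁⟩ := hCc.exists_bound_of_continuousOn ((hp.sub hu).mono hC)
    obtain ⟨M₂, hM₂⟩ := hCc.exists_bound_of_continuousOn ((hp.add hu).mono hC)
    exact ⟨max 1 (max M₁ M₂), by positivity, fun t ht =>
      ⟨(hM₁ t ht).trans (by simp), (hM₂ t ht).trans (by simp)⟩⟩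
end

section
/- Fix t > 0 and consider the cubic equation in z: z³ − (1/t² + 12t²) z² + (80 + 48t⁴) z − (8/t − 8t³)² = 0. Then this equation has exactly one real root and a pair of non-real complex conjugate roots, and its unique real root is nonnegative. -/
/-- The resolvent cubic `z³ - (1/t² + 12t²) z² + (80 + 48t⁴) z - (8/t - 8t³)²`
(as a function of a real variable `z`, with real parameter `t`). -/
noncomputable def resolventCubicReal (t z : ℝ) : ℝ :=
  z ^ 3 - (1 / t ^ 2 + 12 * t ^ 2) * z ^ 2 + (80 + 48 * t ^ 4) * z
    - (8 / t - 8 * t ^ 3) ^ 2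

/-- The same cubic viewed as a function of a complex variable `z`. -/
noncomputable def resolventCubicComplex (t : ℝ) (z : ℂ) : ℂ :=
  z ^ 3 - ((1 / t ^ 2 + 12 * t ^ 2 : ℝ) : ℂ) * z ^ 2
    + ((80 + 48 * t ^ 4 : ℝ) : ℂ) * z - (((8 / t - 8 * t ^ 3) ^ 2 : ℝ) : ℂ)

/-- The discriminant of a cubic with root `x` is that of the complementary quadratic factor times
the square of the derivative at `x`. -/
theorem cubic_discr_eq_of_root {R : Type*} [CommRing R] {a b d x : R}
    (hx : x ^ 3 - a * x ^ 2 + b * x - d = 0) :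
    a ^ 2 * b ^ 2 - 4 * b ^ 3 - 4 * a ^ 3 * d + 18 * a * b * d - 27 * d ^ 2 =
      ((a - x) ^ 2 - 4 * (x ^ 2 - a * x + b)) * (3 * x ^ 2 - 2 * a * x + b) ^ 2 := by
  obtain rfl : d = x ^ 3 - a * x ^ 2 + b * x := (sub_eq_zero.mp hx).symm
  ring

/-- A real cubic with a real root `x` and negative discriminant has, besides `x`, a pair of
non-real complex conjugate roots. -/
theorem exists_conj_factorization_of_cubic_discr_neg {a b d x : ℝ}
    (hx : x ^ 3 - a * x ^ 2 + b * x - d = 0)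
    (hdisc : a ^ 2 * b ^ 2 - 4 * b ^ 3 - 4 * a ^ 3 * d + 18 * a * b * d - 27 * d ^ 2 < 0) :
    ∃ w : ℂ, w.im ≠ 0 ∧ ∀ z : ℂ, z ^ 3 - (a : ℂ) * z ^ 2 + (b : ℂ) * z - (d : ℂ) =
      (z - x) * ((z - w) * (z - (starRingEnd ℂ) w)) := by
  rw [cubic_discr_eq_of_root hx] at hdisc
  have hD : (a - x) ^ 2 - 4 * (x ^ 2 - a * x + b) < 0 := neg_of_mul_neg_left hdisc (sq_nonneg _)
  set r := √(-((a - x) ^ 2 - 4 * (x ^ 2 - a * x + b)))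
  have hr0 : 0 < r := Real.sqrt_pos.mpr (neg_pos.mpr hD)
  have hr2 : r ^ 2 = -((a - x) ^ 2 - 4 * (x ^ 2 - a * x + b)) :=
    Real.sq_sqrt (neg_pos.mpr hD).le
  refine ⟨⟨(a - x) / 2, r / 2⟩, by simpa using hr0.ne', fun z ↦ ?_⟩
  have hconj : (z - ⟨(a - x) / 2, r / 2⟩) * (z - (starRingEnd ℂ) ⟨(a - x) / 2, r / 2⟩) =
      z ^ 2 - (a - x) * z + (x ^ 2 - a * x + b) := by
    have hr2' : (r : ℂ) ^ 2 = -((a - x) ^ 2 - 4 * (x ^ 2 - a * x + b)) := by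
      exact_mod_cast congrArg ((↑) : ℝ → ℂ) hr2
    rw [Complex.mk_eq_add_mul_I]
    simp only [map_add, map_mul, Complex.conj_ofReal, Complex.conj_I]
    push_cast
    linear_combination hr2' / 4 - (r : ℂ) ^ 2 / 4 * Complex.I_sq
  have hx' : (x : ℂ) ^ 3 - a * x ^ 2 + b * x - d = 0 := by exact_mod_cast hx
  rw [hconj]
  linear_combination hx'

theorem exists_nonneg_root_resolventCubicReal {t : ℝ} (ht : 0 < t) :
    ∃ x : ℝ, 0 ≤ x ∧ resolventCubicReal t x = 0 := by
  have ha : 0 ≤ 1 / t ^ 2 + 12 * t ^ 2 := by positivity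
  have hcont : Continuous (resolventCubicReal t) := by
    unfold resolventCubicReal
    fun_prop
  have h0 : resolventCubicReal t 0 ≤ 0 := by
    simp only [resolventCubicReal]
    nlinarith [sq_nonneg (8 / t - 8 * t ^ 3)]
  have h1 : 0 ≤ resolventCubicReal t (1 / t ^ 2 + 12 * t ^ 2) := by
    have h : resolventCubicReal t (1 / t ^ 2 + 12 * t ^ 2) =
        (16 + 1136 * t ^ 4 + 512 * t ^ 8) / t ^ 2 := by
      unfold resolventCubicReal
      field_simp
      ring
    rw [h]
    positivity
  obtain ⟨x, hx, hfx⟩ := intermediate_value_Icc ha hcont.continuousOn ⟨h0, h1⟩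
  exact ⟨x, hx.1, hfx⟩

theorem resolventCubic_discr_neg {t a b d : ℝ} (ht : 0 < t) (ha : a = 1 / t ^ 2 + 12 * t ^ 2)
    (hb : b = 80 + 48 * t ^ 4) (hd : d = (8 / t - 8 * t ^ 3) ^ 2) :
    a ^ 2 * b ^ 2 - 4 * b ^ 3 - 4 * a ^ 3 * d + 18 * a * b * d - 27 * d ^ 2 < 0 := by
  have h : a ^ 2 * b ^ 2 - 4 * b ^ 3 - 4 * a ^ 3 * d + 18 * a * b * d - 27 * d ^ 2 =
      -(256 * (1 + 27 * t ^ 4) ^ 3 / t ^ 8) := by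
    rw [ha, hb, hd]
    field_simp
    ring
  rw [h, neg_lt_zero]
  positivity

/-- For every `t > 0` the cubic
`z³ - (1/t² + 12t²) z² + (80 + 48t⁴) z - (8/t - 8t³)² = 0` has exactly one
real root, which is nonnegative, together with a pair of non-real complex
conjugate roots. -/
theorem resolvent_cubic_root_structure (t : ℝ) (ht : 0 < t) :
    ∃ x : ℝ, 0 ≤ x ∧ resolventCubicReal t x = 0 ∧
      (∀ y : ℝ, resolventCubicReal t y = 0 → y = x) ∧
      ∃ w : ℂ, w.im ≠ 0 ∧ resolventCubicComplex t w = 0 ∧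
        resolventCubicComplex t ((starRingEnd ℂ) w) = 0 ∧
        ∀ z : ℂ, resolventCubicComplex t z = 0 →
          z = (x : ℂ) ∨ z = w ∨ z = (starRingEnd ℂ) w := by
  obtain ⟨x, hx0, hx⟩ := exists_nonneg_root_resolventCubicReal ht
  obtain ⟨w, hw, hfac⟩ := exists_conj_factorization_of_cubic_discr_neg hx
    (resolventCubic_discr_neg ht rfl rfl rfl)
  have hroot (z : ℂ) : resolventCubicComplex t z = 0 ↔
      z = x ∨ z = w ∨ z = (starRingEnd ℂ) w := by
    rw [resolventCubicComplex, hfac z]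
    simp only [mul_eq_zero, sub_eq_zero]
  refine ⟨x, hx0, hx, fun y hy ↦ ?_, w, hw, (hroot w).mpr (by simp), (hroot _).mpr (by simp),
    fun z ↦ (hroot z).mp⟩
  have hy' : resolventCubicComplex t y = 0 := by
    rw [resolventCubicReal] at hy
    rw [resolventCubicComplex]
    exact_mod_cast hy
  rcases (hroot y).mp hy' with h | h | h
  · exact_mod_cast h
  · exact absurd (by simp [← h]) hw
  · exact absurd (by simpa using (congrArg Complex.im h).symm) hw
end
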